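/- Let G be a finitely generated nilpotent group. For m ≥ 1 let a_m(G) denote the number of subgroups of G of index m (this number is finite). Then the function m ↦ a_m(G) is multiplicative: if gcd(m, m') = 1 then a_{m m'}(G) = a_m(G) · a_{m'}(G). Consequently the zeta function ζ_G(s) = ∑_m a_m(G) m^{−s} has an Euler product ζ_G(s) = ∏_p ζ_{G,p}(s) over the primes p. -/

import Mathlib

/-- A finitely generated group has finitely many homomorphisms to a finite group. -/
theorem Group.FG.finite_monoidHom (G P : Type*) [Group G] [Group.FG G] [Group P] [Finite P] :
    Finite (G →* P) := by
  obtain ⟨S, hS, hfin⟩ := Group.fg_iff.mp ‹Group.FG G›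
  have : Finite S := hfin
  refine Finite.of_injective (fun (φ : G →* P) (s : S) => φ s) fun φ ψ h => ?_
  exact MonoidHom.eq_of_eqOn_dense hS fun s hs => congrFun h ⟨s, hs⟩

/-- A finitely generated group has finitely many subgroups of a given positive index. -/
theorem Subgroup.finite_setOf_index_eq (G : Type*) [Group G] [Group.FG G] {m : ℕ} (hm : m ≠ 0) :
    {H : Subgroup G | H.index = m}.Finite := by
  have := Group.FG.finite_monoidHom G (Equiv.Perm (Fin m))
  refine (Set.finite_range fun x : (G →* Equiv.Perm (Fin m)) × Fin m =>
    (MulAction.stabilizer (Equiv.Perm (Fin m)) x.2).comap x.1).subset ?_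
  intro H hH
  have hH : H.index = m := hH
  have : Finite (G ⧸ H) := Subgroup.index_ne_zero_iff_finite.mp (hH ▸ hm)
  let e : G ⧸ H ≃ Fin m := Finite.equivFinOfCardEq hH
  refine ⟨(e.permCongrHom.toMonoidHom.comp (MulAction.toPermHom G (G ⧸ H)),
    e (QuotientGroup.mk 1)), ?_⟩
  ext g
  simp [MulAction.mem_stabilizer_iff, Equiv.permCongrHom, QuotientGroup.eq]

theorem Subgroup.index_inf_of_coprime {G : Type*} [Group G] {H K : Subgroup G} (hH : H.index ≠ 0)
    (hK : K.index ≠ 0) (h : Nat.Coprime H.index K.index) :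
    (H ⊓ K).index = H.index * K.index :=
  le_antisymm Subgroup.index_inf_le <|
    Nat.le_of_dvd (Nat.pos_of_ne_zero (Subgroup.index_inf_ne_zero hH hK)) <|
      h.mul_dvd_of_dvd_of_dvd (Subgroup.index_dvd_of_le inf_le_left)
        (Subgroup.index_dvd_of_le inf_le_right)

theorem Subgroup.card_sup_of_coprime {G : Type*} [Group G] [Finite G] (H K : Subgroup G)
    [K.Normal] (h : Nat.Coprime (Nat.card H) (Nat.card K)) :
    Nat.card (H ⊔ K : Subgroup G) = Nat.card H * Nat.card K := by
  refine Nat.dvd_antisymm ?_ (h.mul_dvd_of_dvd_of_dvd (Subgroup.card_dvd_of_le le_sup_left)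
    (Subgroup.card_dvd_of_le le_sup_right))
  have h1 := Subgroup.relIndex_mul_relIndex ⊥ K (H ⊔ K) bot_le le_sup_right
  rw [Subgroup.relIndex_bot_left, Subgroup.relIndex_bot_left, Subgroup.relIndex_sup_right] at h1
  rw [← h1, mul_comm]
  exact mul_dvd_mul_right (Subgroup.relIndex_dvd_card K H) _

/-- A finite nilpotent group has a normal Hall subgroup of every possible order. -/
theorem Group.IsNilpotent.exists_normal_card_eq {G : Type*} [Group G] [Finite G]
    [Group.IsNilpotent G] {b : ℕ} (a : ℕ) (hab : Nat.card G = a * b) (h : Nat.Coprime a b) :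
    ∃ K : Subgroup G, K.Normal ∧ Nat.card K = b := by
  induction b using Nat.recOnPosPrimePosCoprime generalizing a with
  | prime_pow p n hp hn =>
    have := Fact.mk hp
    obtain ⟨P⟩ : Nonempty (Sylow p G) := inferInstance
    refine ⟨P, inferInstance, ?_⟩
    have ha : ¬ p ∣ a := fun hpa =>
      hp.one_lt.ne' (Nat.Coprime.eq_one_of_dvd (h.symm.coprime_dvd_left (dvd_pow_self p hn.ne')) hpa)
    have ha0 : a ≠ 0 := by rintro rfl; simp at ha
    rw [P.card_eq_multiplicity, hab, Nat.factorization_mul ha0 (pow_ne_zero _ hp.ne_zero)]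
    simp [hp.factorization_self, Nat.factorization_eq_zero_of_not_dvd ha]
  | zero => simp [Nat.card_pos.ne'] at hab
  | one => exact ⟨⊥, inferInstance, by simp⟩
  | coprime b c hb hc hbc ihb ihc =>
    obtain ⟨K, hK, hKb⟩ := ihb (a * c) (by rw [hab]; ring)
      (Nat.Coprime.mul_left h.coprime_mul_right_right hbc.symm)
    obtain ⟨L, hL, hLc⟩ := ihc (a * b) (by rw [hab]; ring)
      (Nat.Coprime.mul_left h.coprime_mul_left_right hbc)
    refine ⟨K ⊔ L, inferInstance, ?_⟩
    rw [Subgroup.card_sup_of_coprime K L (by rwa [hKb, hLc]), hKb, hLc]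

theorem Group.IsNilpotent.exists_normal_index_eq {G : Type*} [Group G] [Group.IsNilpotent G]
    (N : Subgroup G) [N.Normal] [N.FiniteIndex] {a b : ℕ} (hab : N.index = a * b)
    (h : Nat.Coprime a b) :
    ∃ K : Subgroup G, K.Normal ∧ K.index = a ∧ N.relIndex K = b := by
  obtain ⟨K, hK, hKb⟩ := Group.IsNilpotent.exists_normal_card_eq (G := G ⧸ N) a hab h
  have hb : b ≠ 0 := hKb ▸ Nat.card_pos.ne'
  have hidx : (K.comap (QuotientGroup.mk' N)).index = a := by
    rw [Subgroup.index_comap_of_surjective _ (QuotientGroup.mk'_surjective N)]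
    refine Nat.eq_of_mul_eq_mul_left (Nat.pos_of_ne_zero hb) ?_
    rw [← hKb, Subgroup.card_mul_index, hKb, mul_comm]
    exact hab
  have ha : a ≠ 0 := by
    rintro rfl
    exact Subgroup.FiniteIndex.index_ne_zero (H := N) (by simpa using hab)
  refine ⟨K.comap (QuotientGroup.mk' N), inferInstance, hidx, ?_⟩
  refine Nat.eq_of_mul_eq_mul_right (Nat.pos_of_ne_zero ha) ?_
  have := Subgroup.relIndex_mul_index (QuotientGroup.le_comap_mk' N K)
  rw [hidx, hab] at this
  rw [this, mul_comm]

theorem Nat.exists_coprime_mul_eq_of_coprime {n m m' : ℕ} (hn : n ≠ 0) (hmn : m ∣ n)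
    (hmn' : m' ∣ n) (h : Nat.Coprime m m') :
    ∃ a b, n = a * b ∧ Nat.Coprime a b ∧ m ∣ a ∧ m' ∣ b := by
  obtain ⟨b, hb, hmax⟩ := Finset.exists_max_image {d ∈ n.divisors | Nat.Coprime m d} id
    ⟨1, by simp [hn]⟩
  simp only [Finset.mem_filter, Nat.mem_divisors, id] at hb hmax
  obtain ⟨⟨⟨a, rfl⟩, -⟩, hmb⟩ := hb
  have hb0 : 0 < b := Nat.pos_of_ne_zero (left_ne_zero_of_mul hn)
  refine ⟨a, b, mul_comm _ _, ?_, hmb.dvd_of_dvd_mul_left hmn, ?_⟩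
  · refine Nat.Coprime.symm (Nat.coprime_of_dvd fun p hp hpb hpa => ?_)
    have := hmax (b * p) ⟨⟨mul_dvd_mul_left b hpa, hn⟩,
      hmb.mul_right (hmb.coprime_dvd_right hpb)⟩
    have := hp.two_le
    nlinarith
  · have hle := hmax (Nat.lcm b m') ⟨⟨Nat.lcm_dvd (dvd_mul_right _ _) hmn', hn⟩,
      (hmb.mul_right h).coprime_dvd_right (Nat.lcm_dvd_mul b m')⟩
    have hlcm : b ∣ Nat.lcm b m' := Nat.dvd_lcm_left _ _
    have hpos : 0 < Nat.lcm b m' := Nat.pos_of_dvd_of_pos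
      (Nat.lcm_dvd (dvd_mul_right b a) hmn') (Nat.pos_of_ne_zero hn)
    rw [Nat.dvd_antisymm hlcm (by rw [le_antisymm hle (Nat.le_of_dvd hpos hlcm)])]
    exact Nat.dvd_lcm_right _ _

theorem Subgroup.eq_of_le_of_index_eq {G : Type*} [Group G] {H K : Subgroup G} (hle : H ≤ K)
    (h0 : H.index ≠ 0) (h : H.index = K.index) : H = K := by
  refine le_antisymm hle (Subgroup.relIndex_eq_one.mp ?_)
  refine Nat.eq_of_mul_eq_mul_right (Nat.pos_of_ne_zero (h ▸ h0)) ?_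
  rw [Subgroup.relIndex_mul_index hle, one_mul, h]

theorem Subgroup.relIndex_sup_of_normal_right {G : Type*} [Group G] (A K : Subgroup G) [K.Normal]
    [K.FiniteIndex] : A.relIndex (A ⊔ K) = A.relIndex K := by
  have hpos : 0 < K.relIndex A := Nat.pos_of_ne_zero fun h0 =>
    Subgroup.FiniteIndex.index_ne_zero (H := K)
      (zero_dvd_iff.mp (h0 ▸ Subgroup.relIndex_dvd_index_of_normal K A))
  refine Nat.eq_of_mul_eq_mul_left hpos ?_
  have h1 := Subgroup.relIndex_mul_relIndex (A ⊓ K) A (A ⊔ K) inf_le_left le_sup_left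
  have h2 := Subgroup.relIndex_mul_relIndex (A ⊓ K) K (A ⊔ K) inf_le_right le_sup_right
  rw [Subgroup.inf_relIndex_left] at h1
  rw [Subgroup.inf_relIndex_right, Subgroup.relIndex_sup_right] at h2
  rw [h1, ← h2, mul_comm]

/-- In a nilpotent group, a subgroup whose index is a product of coprime factors `m` and `m'` lies
in exactly one subgroup of index `m`. -/
theorem Group.IsNilpotent.existsUnique_le_index_eq {G : Type*} [Group G] [Group.IsNilpotent G]
    {H : Subgroup G} {m m' : ℕ} (hm : m ≠ 0) (hm' : m' ≠ 0) (h : Nat.Coprime m m')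
    (hH : H.index = m * m') : ∃! A : Subgroup G, H ≤ A ∧ A.index = m := by
  have : H.FiniteIndex := ⟨hH ▸ mul_ne_zero hm hm'⟩
  have hdvd : m * m' ∣ H.normalCore.index := hH ▸ Subgroup.index_dvd_of_le H.normalCore_le
  obtain ⟨a, b, hab, hcop, hma, hmb⟩ := Nat.exists_coprime_mul_eq_of_coprime
    Subgroup.FiniteIndex.index_ne_zero (dvd_of_mul_right_dvd hdvd) (dvd_of_mul_left_dvd hdvd) h
  obtain ⟨K, hK, hKa, hKb⟩ := Group.IsNilpotent.exists_normal_index_eq H.normalCore hab hcop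
  have hrel {A : Subgroup G} (hA : H ≤ A) : A.relIndex K ∣ b :=
    hKb ▸ Subgroup.relIndex_dvd_of_le_left K (H.normalCore_le.trans hA)
  have : K.FiniteIndex := ⟨hKa ▸ left_ne_zero_of_mul (hab ▸ Subgroup.FiniteIndex.index_ne_zero)⟩
  have hsup (A : Subgroup G) : A.relIndex (A ⊔ K) = A.relIndex K :=
    Subgroup.relIndex_sup_of_normal_right A K
  have hex : (H ⊔ K).index = m := by
    have hmul := Subgroup.relIndex_mul_index (le_sup_left : H ≤ H ⊔ K)
    rw [hsup, hH] at hmul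
    have hidx : (H ⊔ K).index ∣ a := hKa ▸ Subgroup.index_dvd_of_le le_sup_right
    refine Nat.dvd_antisymm ?_ ?_
    · exact ((hcop.coprime_dvd_left hidx).coprime_dvd_right hmb).dvd_of_dvd_mul_right
        (hmul ▸ dvd_mul_left _ _)
    · exact ((hcop.coprime_dvd_left hma).coprime_dvd_right (hrel le_rfl)).dvd_of_dvd_mul_left
        (hmul ▸ dvd_mul_right _ _)
  refine ⟨H ⊔ K, ⟨le_sup_left, hex⟩, fun A ⟨hHA, hA⟩ => ?_⟩
  have hKA : K ≤ A := by
    rw [← Subgroup.relIndex_eq_one]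
    refine Nat.Coprime.eq_one_of_dvd ((hcop.coprime_dvd_left hma).symm.coprime_dvd_left
      (hrel hHA)) ?_
    rw [← hsup, ← hA]
    exact Subgroup.relIndex_dvd_index_of_le le_sup_left
  exact (Subgroup.eq_of_le_of_index_eq (sup_le hHA hKA) (hex ▸ hm) (hex.trans hA.symm)).symm


/-- For a finitely generated nilpotent group `G` and `m ≥ 1`, the number `a_m(G)` of
subgroups of `G` of index `m` is finite, and `m ↦ a_m(G)` is multiplicative: if
`gcd(m, m') = 1` then `a_{mm'}(G) = a_m(G)·a_{m'}(G)`. (This is the coefficient-wise form of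
the Euler product `ζ_G(s) = ∏_p ζ_{G,p}(s)`.) -/
theorem subgroup_counting_function_multiplicative
    (G : Type*) [Group G] [Group.FG G] [Group.IsNilpotent G] :
    (∀ m : ℕ, 1 ≤ m → {H : Subgroup G | H.index = m}.Finite) ∧
    ∀ m m' : ℕ, 1 ≤ m → 1 ≤ m' → Nat.Coprime m m' →
      Nat.card {H : Subgroup G // H.index = m * m'} =
        Nat.card {H : Subgroup G // H.index = m} *
          Nat.card {H : Subgroup G // H.index = m'} := by
  refine ⟨fun m hm => Subgroup.finite_setOf_index_eq G (Nat.one_le_iff_ne_zero.mp hm),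
    fun m m' hm hm' h => ?_⟩
  rw [Nat.one_le_iff_ne_zero] at hm hm'
  have hinf {A B : Subgroup G} (hA : A.index = m) (hB : B.index = m') :
      (A ⊓ B).index = m * m' := by
    subst hA hB
    exact Subgroup.index_inf_of_coprime hm hm' h
  rw [← Nat.card_prod]
  symm
  refine Nat.card_eq_of_bijective (fun x : {H : Subgroup G // H.index = m} ×
    {H : Subgroup G // H.index = m'} =>
      (⟨x.1.1 ⊓ x.2.1, hinf x.1.2 x.2.2⟩ : {H : Subgroup G // H.index = m * m'})) ⟨?_, ?_⟩
  · rintro ⟨⟨A, hA⟩, ⟨B, hB⟩⟩ ⟨⟨A', hA'⟩, ⟨B', hB'⟩⟩ heq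
    have heq : A ⊓ B = A' ⊓ B' := congrArg Subtype.val heq
    have hAB := hinf hA hB
    have h1 : A = A' := (Group.IsNilpotent.existsUnique_le_index_eq hm hm' h hAB).unique
      ⟨inf_le_left, hA⟩ ⟨heq.trans_le inf_le_left, hA'⟩
    have h2 : B = B' := (Group.IsNilpotent.existsUnique_le_index_eq hm' hm h.symm
      (hAB.trans (mul_comm _ _))).unique ⟨inf_le_right, hB⟩ ⟨heq.trans_le inf_le_right, hB'⟩
    subst h1 h2
    rfl
  · rintro ⟨H, hH⟩
    obtain ⟨A, ⟨hHA, hA⟩, -⟩ := Group.IsNilpotent.existsUnique_le_index_eq hm hm' h hH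
    obtain ⟨B, ⟨hHB, hB⟩, -⟩ := Group.IsNilpotent.existsUnique_le_index_eq hm' hm h.symm
      (hH.trans (mul_comm _ _))
    refine ⟨(⟨A, hA⟩, ⟨B, hB⟩), Subtype.ext ?_⟩
    exact (Subgroup.eq_of_le_of_index_eq (le_inf hHA hHB) (hH ▸ mul_ne_zero hm hm')
      (hH.trans (hinf hA hB).symm)).symm
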